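/- For every integer N ≥ 1, as x → +∞ (x real) one has F(x) = −π²/(12x) − ∑_{n=2}^{N} (B_n·ζ(n+1)/n)·x^{−n} + O(x^{−N−1}), where B_n are the Bernoulli numbers and ζ is the Riemann zeta function. -/

import Mathlib

open Real Filter

/-- The digamma function ψ = Γ′/Γ. -/
noncomputable def digamma (x : ℝ) : ℝ := deriv Real.Gamma x / Real.Gamma x

/-- The Herglotz function F(x) = ∑_{n≥1} (ψ(nx) − log(nx))/n. -/
noncomputable def herglotzF (x : ℝ) : ℝ :=
  ∑' n : ℕ, (digamma (((n : ℝ) + 1) * x) - Real.log (((n : ℝ) + 1) * x)) / ((n : ℝ) + 1)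

lemma digamma_add_one {y : ℝ} (hy : 0 < y) : digamma (y + 1) = digamma y + 1 / y := by
  have hG := (Real.Gamma_pos_of_pos hy).ne'
  have hd (z : ℝ) (hz : 0 < z) : HasDerivAt Real.Gamma (deriv Real.Gamma z) z :=
    (Real.differentiableAt_Gamma fun m => by
      have : (0 : ℝ) ≤ m := m.cast_nonneg
      linarith).hasDerivAt
  have h1 : HasDerivAt (fun z => Real.Gamma (z + 1)) (deriv Real.Gamma (y + 1)) y :=
    (hd (y + 1) (by linarith)).comp_add_const y 1
  have h2 : HasDerivAt (fun z => z * Real.Gamma z) (1 * Real.Gamma y + y * deriv Real.Gamma y) y :=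
    (hasDerivAt_id y).mul (hd y hy)
  have h3 : (fun z => Real.Gamma (z + 1)) =ᶠ[nhds y] fun z => z * Real.Gamma z := by
    filter_upwards [lt_mem_nhds hy] with z hz
    exact Real.Gamma_add_one hz.ne'
  have h4 := h1.unique (h2.congr_of_eventuallyEq h3)
  rw [digamma, digamma, h4, Real.Gamma_add_one hy.ne']
  field_simp
  ring

lemma hasDerivAt_log_Gamma {y : ℝ} (hy : 0 < y) :
    HasDerivAt (Real.log ∘ Real.Gamma) (digamma y) y :=
  (Real.differentiableAt_Gamma fun m => by
    have : (0 : ℝ) ≤ m := m.cast_nonneg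
    linarith).hasDerivAt.log (Real.Gamma_pos_of_pos hy).ne'

lemma log_Gamma_add_one {y : ℝ} (hy : 0 < y) :
    Real.log (Real.Gamma (y + 1)) = Real.log (Real.Gamma y) + Real.log y := by
  rw [Real.Gamma_add_one hy.ne', Real.log_mul hy.ne' (Real.Gamma_pos_of_pos hy).ne', add_comm]

lemma digamma_le_log {y : ℝ} (hy : 0 < y) : digamma y ≤ Real.log y := by
  have h := Real.convexOn_log_Gamma.le_slope_of_hasDerivAt (Set.mem_Ioi.2 hy)
    (Set.mem_Ioi.2 (by linarith : 0 < y + 1)) (by linarith) (hasDerivAt_log_Gamma hy)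
  simpa [slope_def_field, log_Gamma_add_one hy] using h

lemma log_le_digamma_add_one {y : ℝ} (hy : 0 < y) : Real.log y ≤ digamma (y + 1) := by
  have h := Real.convexOn_log_Gamma.slope_le_of_hasDerivAt (Set.mem_Ioi.2 hy)
    (Set.mem_Ioi.2 (by linarith : 0 < y + 1)) (by linarith)
    (hasDerivAt_log_Gamma (by linarith : 0 < y + 1))
  simpa [slope_def_field, log_Gamma_add_one hy] using h

lemma tendsto_digamma_sub_log :
    Tendsto (fun y => digamma y - Real.log y) atTop (nhds 0) := by
  have hinv : Tendsto (fun y : ℝ => -(1 / y)) atTop (nhds 0) := by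
    simpa using (tendsto_inv_atTop_zero (𝕜 := ℝ)).neg
  refine tendsto_of_tendsto_of_tendsto_of_le_of_le' hinv tendsto_const_nhds ?_ ?_
  · filter_upwards [eventually_gt_atTop 0] with y hy
    have h := log_le_digamma_add_one hy
    rw [digamma_add_one hy] at h
    linarith
  · filter_upwards [eventually_gt_atTop 0] with y hy
    linarith [digamma_le_log hy]

lemma integral_bernoulliFun_mul_inv_pow {y : ℝ} (hy : 0 < y) (k : ℕ) :
    ∫ t in (0 : ℝ)..1, bernoulliFun k t * ((y + t) ^ (k + 1))⁻¹ =
      bernoulliFun (k + 1) 1 / (k + 1) * ((y + 1) ^ (k + 1))⁻¹ -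
        bernoulliFun (k + 1) 0 / (k + 1) * (y ^ (k + 1))⁻¹ +
      ∫ t in (0 : ℝ)..1, bernoulliFun (k + 1) t * ((y + t) ^ (k + 2))⁻¹ := by
  have hpos (t : ℝ) (ht : t ∈ Set.uIcc (0 : ℝ) 1) : 0 < y + t := by
    rw [Set.uIcc_of_le zero_le_one] at ht
    linarith [ht.1]
  have hint (j m : ℕ) : IntervalIntegrable (fun t => bernoulliFun j t * ((y + t) ^ m)⁻¹)
      MeasureTheory.volume 0 1 := by
    apply ContinuousOn.intervalIntegrable
    exact (continuous_bernoulliFun j).continuousOn.mul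
      (ContinuousOn.inv₀ (by fun_prop) fun t ht => (pow_pos (hpos t ht) m).ne')
  have hderiv (t : ℝ) (ht : t ∈ Set.uIcc (0 : ℝ) 1) :
      HasDerivAt (fun t => bernoulliFun (k + 1) t / (k + 1) * ((y + t) ^ (k + 1))⁻¹)
        (bernoulliFun k t * ((y + t) ^ (k + 1))⁻¹ -
          bernoulliFun (k + 1) t * ((y + t) ^ (k + 2))⁻¹) t := by
    have hp := (hpos t ht).ne'
    have h1 := (hasDerivAt_bernoulliFun (k + 1) t).div_const ((k : ℝ) + 1)
    have h2 := (((hasDerivAt_id t).const_add y).pow (k + 1)).inv (pow_ne_zero _ hp)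
    refine (h1.mul h2).congr_deriv ?_
    have hk : (k : ℝ) + 1 ≠ 0 := by positivity
    simp only [id, Pi.pow_apply, Pi.inv_apply, Nat.add_sub_cancel]
    push_cast
    field_simp
    ring
  have h := intervalIntegral.integral_eq_sub_of_hasDerivAt hderiv
    ((hint k (k + 1)).sub (hint (k + 1) (k + 2)))
  rw [intervalIntegral.integral_sub (hint _ _) (hint _ _)] at h
  rw [add_zero] at h
  linarith

lemma bernoulliFun_eval_one_eq_bernoulli' (k : ℕ) : bernoulliFun k 1 = (bernoulli' k : ℝ) := by
  rw [bernoulliFun, Polynomial.eval_one_map, Polynomial.bernoulli_eval_one, eq_ratCast]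

/-- The Euler–Maclaurin expansion of `log (y + 1) - log y` with integral remainder. -/
lemma log_add_one_sub_log {y : ℝ} (hy : 0 < y) (N : ℕ) :
    Real.log (y + 1) - Real.log y =
      (if N = 0 then 0 else 1 / y) + ∑ m ∈ Finset.range N, (bernoulli' (m + 1) : ℝ) / (m + 1) *
        (((y + 1) ^ (m + 1))⁻¹ - (y ^ (m + 1))⁻¹) +
      ∫ t in (0 : ℝ)..1, bernoulliFun N t * ((y + t) ^ (N + 1))⁻¹ := by
  induction N with
  | zero =>
    have h : ∫ t in (0 : ℝ)..1, (y + t)⁻¹ = Real.log ((y + 1) / y) := by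
      rw [intervalIntegral.integral_comp_add_left (fun t => t⁻¹) y, add_zero,
        integral_inv_of_pos hy (by linarith)]
    simp only [bernoulliFun_zero]
    simp [h, Real.log_div (by linarith : y + 1 ≠ 0) hy.ne']
  | succ N ih =>
    rw [ih, integral_bernoulliFun_mul_inv_pow hy, Finset.sum_range_succ,
      bernoulliFun_eval_one_eq_bernoulli']
    have h0 := bernoulliFun_eval_one (N + 1)
    rw [bernoulliFun_eval_one_eq_bernoulli'] at h0
    rcases N with _ | N
    · simp at h0 ⊢
      rw [h0]
      ring
    · simp at h0 ⊢
      rw [h0]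
      ring

lemma abs_integral_bernoulliFun_mul_inv_pow_le (N : ℕ) :
    ∃ C : ℝ, 0 ≤ C ∧ ∀ y : ℝ, 0 < y →
      |∫ t in (0 : ℝ)..1, bernoulliFun N t * ((y + t) ^ (N + 1))⁻¹| ≤ C * (y ^ (N + 1))⁻¹ := by
  obtain ⟨C, hC⟩ := (isCompact_Icc (a := (0 : ℝ)) (b := 1)).exists_bound_of_continuousOn
    (continuous_bernoulliFun N).continuousOn
  have hC0 : 0 ≤ C := (norm_nonneg _).trans (hC 0 (by simp))
  refine ⟨C, hC0, fun y hy => ?_⟩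
  have h := intervalIntegral.norm_integral_le_of_norm_le_const (a := (0 : ℝ)) (b := 1)
    (f := fun t => bernoulliFun N t * ((y + t) ^ (N + 1))⁻¹) (C := C * (y ^ (N + 1))⁻¹) ?_
  · simpa using h
  · intro t ht
    rw [Set.uIoc_of_le zero_le_one] at ht
    have ht0 := ht.1
    rw [norm_mul, norm_inv, norm_pow, Real.norm_of_nonneg (by linarith : 0 ≤ y + t)]
    gcongr
    · exact hC t ⟨ht.1.le, ht.2⟩
    · linarith

/-- The remainder of the Stirling-type asymptotic expansion of the digamma function. -/
noncomputable def digammaRemainder (N : ℕ) (y : ℝ) : ℝ :=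
  digamma y - Real.log y +
    ∑ m ∈ Finset.range N, (bernoulli' (m + 1) : ℝ) / (m + 1) * (y ^ (m + 1))⁻¹

lemma tendsto_digammaRemainder (N : ℕ) : Tendsto (digammaRemainder N) atTop (nhds 0) := by
  have h : Tendsto (fun y : ℝ => ∑ m ∈ Finset.range N,
      (bernoulli' (m + 1) : ℝ) / (m + 1) * (y ^ (m + 1))⁻¹) atTop (nhds 0) := by
    rw [show (0 : ℝ) = ∑ m ∈ Finset.range N, (bernoulli' (m + 1) : ℝ) / (m + 1) * 0 by simp]
    exact tendsto_finsetSum _ fun m _ =>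
      (tendsto_inv_atTop_zero.comp (tendsto_pow_atTop m.succ_ne_zero)).const_mul _
  simpa [← digammaRemainder.eq_1] using tendsto_digamma_sub_log.add h

lemma digammaRemainder_sub {N : ℕ} (hN : N ≠ 0) {y : ℝ} (hy : 0 < y) :
    digammaRemainder N y - digammaRemainder N (y + 1) =
      ∫ t in (0 : ℝ)..1, bernoulliFun N t * ((y + t) ^ (N + 1))⁻¹ := by
  have h := log_add_one_sub_log hy N
  rw [if_neg hN] at h
  simp only [mul_sub, Finset.sum_sub_distrib] at h
  rw [digammaRemainder, digammaRemainder, digamma_add_one hy]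
  linarith

lemma abs_digammaRemainder_succ_le (N : ℕ) :
    ∃ C : ℝ, 0 ≤ C ∧ ∀ y : ℝ, 1 ≤ y → |digammaRemainder (N + 1) y| ≤ C * (y ^ (N + 1))⁻¹ := by
  obtain ⟨C, hC0, hC⟩ := abs_integral_bernoulliFun_mul_inv_pow_le (N + 1)
  refine ⟨2 * C, by positivity, fun y hy => ?_⟩
  have hy0 : 0 < y := by linarith
  have hstep (k : ℕ) : |digammaRemainder (N + 1) y| ≤ |digammaRemainder (N + 1) (y + k)| +
      2 * C * (y ^ N)⁻¹ * (y⁻¹ - (y + k)⁻¹) := by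
    induction k with
    | zero => simp
    | succ k ih =>
      have hk : (0 : ℝ) ≤ k := k.cast_nonneg
      have hz : 0 < y + k := by linarith
      have h1 := hC (y + k) hz
      rw [← digammaRemainder_sub N.succ_ne_zero hz] at h1
      have h2 := abs_sub_abs_le_abs_sub (digammaRemainder (N + 1) (y + k))
        (digammaRemainder (N + 1) (y + k + 1))
      have h3 : ((y + k) ^ (N + 1 + 1))⁻¹ ≤
          (y ^ N)⁻¹ * (2 * ((y + k)⁻¹ - (y + k + 1)⁻¹)) := by
        rw [add_assoc N, pow_add, mul_inv]
        gcongr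
        · linarith
        · rw [inv_sub_inv (by positivity) (by positivity), ← one_div, ← mul_div_assoc,
            div_le_div_iff₀ (by positivity) (by positivity)]
          have h1z : 1 ≤ y + k := by linarith
          generalize y + (k : ℝ) = z at hz h1z
          rw [one_add_one_eq_two]
          nlinarith [mul_le_mul_of_nonneg_left h1z hz.le]
      have h4 := mul_le_mul_of_nonneg_left h3 hC0
      push_cast
      rw [← add_assoc]
      linarith
  have hlim : Tendsto (fun k : ℕ => y + (k : ℝ)) atTop atTop :=
    tendsto_atTop_add_const_left _ _ tendsto_natCast_atTop_atTop
  have h := (((tendsto_digammaRemainder (N + 1)).comp hlim).abs).add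
    (((tendsto_inv_atTop_zero.comp hlim).const_sub y⁻¹).const_mul (2 * C * (y ^ N)⁻¹))
  have h5 := ge_of_tendsto' h hstep
  calc _ ≤ _ := h5
    _ = _ := by
      rw [abs_zero, pow_succ, mul_inv]
      ring

lemma abs_digammaRemainder_le (N : ℕ) :
    ∃ C : ℝ, 0 ≤ C ∧ ∀ y : ℝ, 1 ≤ y → |digammaRemainder N y| ≤ C * (y ^ (N + 1))⁻¹ := by
  obtain ⟨C, hC0, hC⟩ := abs_digammaRemainder_succ_le N
  refine ⟨C + |(bernoulli' (N + 1) : ℝ) / (N + 1)|, by positivity, fun y hy => ?_⟩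
  have hy0 : 0 < y := by linarith
  have h : digammaRemainder N y = digammaRemainder (N + 1) y -
      (bernoulli' (N + 1) : ℝ) / (N + 1) * (y ^ (N + 1))⁻¹ := by
    rw [digammaRemainder, digammaRemainder, Finset.sum_range_succ]
    ring
  rw [h, add_mul]
  refine (abs_sub _ _).trans (add_le_add (hC y hy) ?_)
  rw [abs_mul, abs_of_pos (by positivity : 0 < (y ^ (N + 1))⁻¹)]

lemma summable_nat_add_one_inv_pow (m : ℕ) :
    Summable fun n : ℕ => (((n : ℝ) + 1) ^ (m + 2))⁻¹ := by
  have h := (summable_nat_add_iff 1).2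
    ((Real.summable_nat_pow_inv (p := m + 2)).2 (by omega))
  simpa using h

lemma hasSum_riemannZeta_re (m : ℕ) :
    HasSum (fun n : ℕ => (((n : ℝ) + 1) ^ (m + 2))⁻¹)
      (riemannZeta (((m + 1 : ℕ) : ℂ) + 1)).re := by
  have h : riemannZeta (((m + 1 : ℕ) : ℂ) + 1) =
      ((∑' n : ℕ, (((n : ℝ) + 1) ^ (m + 2))⁻¹ : ℝ) : ℂ) := by
    have h1 : (((m + 1 : ℕ) : ℂ) + 1) = ((m + 2 : ℕ) : ℂ) := by push_cast; ring
    rw [h1, zeta_eq_tsum_one_div_nat_add_one_cpow (by simp; linarith [m.cast_nonneg (α := ℝ)]),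
      Complex.ofReal_tsum]
    refine tsum_congr fun n => ?_
    rw [Complex.cpow_natCast]
    push_cast
    rw [one_div]
  rw [h, Complex.ofReal_re]
  exact (summable_nat_add_one_inv_pow m).hasSum

lemma herglotzF_add_sum_eq_tsum (N : ℕ) {x : ℝ}
    (h : Summable fun n : ℕ => digammaRemainder N (((n : ℝ) + 1) * x) / ((n : ℝ) + 1)) :
    herglotzF x = (∑' n : ℕ, digammaRemainder N (((n : ℝ) + 1) * x) / ((n : ℝ) + 1)) -
      ∑ m ∈ Finset.range N, (bernoulli' (m + 1) : ℝ) / (m + 1) * (x ^ (m + 1))⁻¹ *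
        (riemannZeta (((m + 1 : ℕ) : ℂ) + 1)).re := by
  have h1 := h.hasSum.sub (hasSum_sum (s := Finset.range N) fun m _ =>
    (hasSum_riemannZeta_re m).mul_left ((bernoulli' (m + 1) : ℝ) / (m + 1) * (x ^ (m + 1))⁻¹))
  rw [← h1.tsum_eq, herglotzF]
  refine tsum_congr fun n => ?_
  rw [digammaRemainder, add_div, Finset.sum_div]
  have h2 : ∀ m ∈ Finset.range N, (bernoulli' (m + 1) : ℝ) / (m + 1) *
      ((((n : ℝ) + 1) * x) ^ (m + 1))⁻¹ / ((n : ℝ) + 1) =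
      (bernoulli' (m + 1) : ℝ) / (m + 1) * (x ^ (m + 1))⁻¹ * (((n : ℝ) + 1) ^ (m + 2))⁻¹ := by
    intro m _
    rw [mul_pow, mul_inv, pow_succ _ (m + 1), mul_inv]
    ring
  rw [Finset.sum_congr rfl h2]
  ring

lemma herglotz_main_terms {N : ℕ} (hN : 1 ≤ N) (x : ℝ) :
    ∑ m ∈ Finset.range N, (bernoulli' (m + 1) : ℝ) / (m + 1) * (x ^ (m + 1))⁻¹ *
        (riemannZeta (((m + 1 : ℕ) : ℂ) + 1)).re =
      Real.pi ^ 2 / (12 * x) + ∑ n ∈ Finset.Icc 2 N,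
        ((bernoulli n : ℝ) * (riemannZeta ((n : ℂ) + 1)).re / n) * x ^ (-(n : ℤ)) := by
  obtain ⟨M, rfl⟩ := Nat.exists_eq_add_of_le' hN
  rw [Finset.sum_range_succ', add_comm]
  congr 1
  · have h : (riemannZeta (((0 + 1 : ℕ) : ℂ) + 1)).re = Real.pi ^ 2 / 6 := by
      have h2 : (((0 + 1 : ℕ) : ℂ) + 1) = 2 := by norm_num
      rw [h2, riemannZeta_two]
      norm_cast
    rw [h]
    simp [bernoulli'_one]
    ring
  · rw [← Finset.Ico_add_one_right_eq_Icc, Finset.sum_Ico_eq_sum_range]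
    refine Finset.sum_congr (by congr 1) fun m _ => ?_
    rw [bernoulli_eq_bernoulli'_of_ne_one (by omega), zpow_neg, zpow_natCast, add_comm 2 m]
    push_cast
    rw [show (m : ℂ) + 1 + 1 = m + 2 by ring]
    ring

/-- The asymptotic expansion F(x) ∼ −π²/(12x) − ∑_{n≥2} (Bₙζ(n+1)/n)x⁻ⁿ as x → ∞:
for each N ≥ 1 the error after truncating at n = N is O(x^{−N−1}). -/
theorem herglotzF_asymptotic (N : ℕ) (hN : 1 ≤ N) :
    (fun x : ℝ => herglotzF x -
        (-(Real.pi ^ 2 / (12 * x)) -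
          ∑ n ∈ Finset.Icc 2 N,
            ((bernoulli n : ℝ) * (riemannZeta ((n : ℂ) + 1)).re / n) * x ^ (-(n : ℤ))))
      =O[atTop] fun x : ℝ => x ^ (-(N : ℤ) - 1) := by
  obtain ⟨C, hC0, hC⟩ := abs_digammaRemainder_le N
  refine Asymptotics.IsBigO.of_bound (C * ∑' n : ℕ, (((n : ℝ) + 1) ^ (N + 2))⁻¹) ?_
  filter_upwards [eventually_ge_atTop 1] with x hx
  have hx0 : 0 < x := by linarith
  have hbound (n : ℕ) : ‖digammaRemainder N (((n : ℝ) + 1) * x) / ((n : ℝ) + 1)‖ ≤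
      C * (x ^ (N + 1))⁻¹ * (((n : ℝ) + 1) ^ (N + 2))⁻¹ := by
    have hn : (0 : ℝ) ≤ n := n.cast_nonneg
    rw [norm_div, Real.norm_eq_abs, Real.norm_of_nonneg (by positivity : (0 : ℝ) ≤ n + 1),
      div_le_iff₀ (by positivity)]
    refine (hC _ (by nlinarith)).trans_eq ?_
    rw [mul_pow]
    field_simp
    ring
  have hsum := (summable_nat_add_one_inv_pow N).mul_left (C * (x ^ (N + 1))⁻¹)
  have hF := herglotzF_add_sum_eq_tsum N (Summable.of_norm_bounded hsum hbound)
  rw [herglotz_main_terms hN] at hF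
  have hz : x ^ (-(N : ℤ) - 1) = (x ^ (N + 1))⁻¹ := by
    rw [← zpow_natCast, ← zpow_neg]
    congr 1
    push_cast
    ring
  have hnorm := tsum_of_norm_bounded hsum.hasSum hbound
  rw [tsum_mul_left] at hnorm
  rw [hz, Real.norm_of_nonneg (by positivity : 0 ≤ (x ^ (N + 1))⁻¹), hF]
  calc _ = ‖∑' n : ℕ, digammaRemainder N (((n : ℝ) + 1) * x) / ((n : ℝ) + 1)‖ := by
        congr 1
        ring
    _ ≤ _ := hnorm
    _ = _ := by ring
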